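/- arXiv:1112.5901 — 4 statements merged into one kernel-verified Lean document; each statement's English description precedes it below -/
import Mathlib

section
/- Let X, Y, E be nonempty sets, H(X;Y) a nonempty family of maps from X to Y, G a Banach space, K a compact Hausdorff topological space, S : H(X;Y) × E × G → [0,∞) an arbitrary map, and R : K × E × G → [0,∞) a map such that for every x ∈ E and b ∈ G the function φ ↦ R(φ, x, b) is continuous on K. Let 1 ≤ p < ∞. Then a map h ∈ H(X;Y) is RS-abstract p-summing if and only if there exist a constant C ≥ 0 and a Borel probability measure μ on K such that S(h, e, b) ≤ C · (∫_K R(φ, e, b)^p dμ(φ))^{1/p} for all e ∈ E and b ∈ G. -/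
open scoped BigOperators
open Finset MeasureTheory

noncomputable section

/-- `f` is `RS`-abstract `t`-summing: there is `C ≥ 0` with
`(∑ⱼ S(f,xⱼ,bⱼ)^t)^(1/t) ≤ C · sup_{φ ∈ K} (∑ⱼ R(φ,xⱼ,bⱼ)^t)^(1/t)`
for all finite families `x` in `E` and `b` in `G`. -/
def RSSumming {K E G H : Type*} [TopologicalSpace K]
    (R : K → E → G → ℝ) (S : H → E → G → ℝ) (t : ℝ) (f : H) : Prop :=
  ∃ C : ℝ, 0 ≤ C ∧ ∀ (m : ℕ) (x : Fin m → E) (b : Fin m → G),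
    (∑ j, S f (x j) (b j) ^ t) ^ (1 / t) ≤
      C * ⨆ φ : K, (∑ j, R φ (x j) (b j) ^ t) ^ (1 / t)

/-- From unweighted finite families to convex combinations. -/
lemma pietsch_weighted {K ι : Type*} [TopologicalSpace K] [CompactSpace K] [Nonempty K]
    (F : ι → C(K, ℝ))
    (hF : ∀ (m : ℕ) (i : Fin m → ι), ∃ φ, 0 ≤ ∑ j, F (i j) φ)
    (J : Type) [Fintype J] (w : J → ℝ) (i : J → ι) (hw : ∀ j, 0 ≤ w j) :
    ∃ φ, 0 ≤ ∑ j, w j * F (i j) φ := by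
  by_contra hcon
  push Not at hcon
  have hc : Continuous fun φ => ∑ j, w j * F (i j) φ := by fun_prop
  obtain ⟨φ₀, -, hmax⟩ := isCompact_univ.exists_isMaxOn (Set.univ_nonempty (α := K))
    hc.continuousOn
  set δ := ∑ j, w j * F (i j) φ₀ with hδ
  have hδ0 : δ < 0 := hcon φ₀
  set M := ∑ j, ‖F (i j)‖ with hM
  obtain ⟨N, hN⟩ := exists_nat_gt (M / (-δ))
  have hN' : M < N * (-δ) := by rwa [div_lt_iff₀ (by linarith)] at hN
  let n : J → ℕ := fun j => ⌊(N : ℝ) * w j⌋₊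
  let e := Fintype.equivFin (Σ j : J, Fin (n j))
  obtain ⟨φ, hφ⟩ := hF _ (fun k => i (e.symm k).1)
  rw [Equiv.sum_comp e.symm (fun s : (Σ j : J, Fin (n j)) => F (i s.1) φ),
    Fintype.sum_sigma] at hφ
  simp only [Finset.sum_const, Finset.card_univ, Fintype.card_fin, nsmul_eq_mul] at hφ
  have h1 : ∑ j, (n j : ℝ) * F (i j) φ ≤ ∑ j, (N * (w j * F (i j) φ) + ‖F (i j)‖) := by
    refine Finset.sum_le_sum fun j _ => ?_
    have ha : (n j : ℝ) ≤ N * w j := Nat.floor_le (mul_nonneg (Nat.cast_nonneg _) (hw j))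
    have hb : (N : ℝ) * w j < n j + 1 := Nat.lt_floor_add_one _
    have hn : |F (i j) φ| ≤ ‖F (i j)‖ := (F (i j)).norm_coe_le_norm φ
    have h3 : ((n j : ℝ) - N * w j) * F (i j) φ ≤ ‖F (i j)‖ := by
      refine (le_abs_self _).trans ?_
      rw [abs_mul]
      have : |(n j : ℝ) - N * w j| ≤ 1 := by rw [abs_le]; constructor <;> linarith
      calc _ ≤ 1 * |F (i j) φ| := by gcongr
        _ ≤ _ := by simpa using hn
    linarith
  rw [Finset.sum_add_distrib, ← Finset.mul_sum] at h1
  have h2 : ∑ j, w j * F (i j) φ ≤ δ := hmax (Set.mem_univ φ)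
  have h4 : (N : ℝ) * ∑ j, w j * F (i j) φ ≤ N * δ := by gcongr
  linarith

/-- Hahn-Banach plus Riesz: existence of the measure. -/
lemma pietsch_measure {K ι : Type*} [TopologicalSpace K] [CompactSpace K] [T2Space K] [Nonempty K]
    [MeasurableSpace K] [BorelSpace K] [Nonempty ι]
    (F : ι → C(K, ℝ))
    (hF : ∀ (m : ℕ) (i : Fin m → ι), ∃ φ, 0 ≤ ∑ j, F (i j) φ) :
    ∃ μ : Measure K, IsProbabilityMeasure μ ∧ ∀ i, 0 ≤ ∫ φ, F i φ ∂μ := by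
  let s : Set C(K, ℝ) := {g | ∀ φ, g φ < 0}
  have hs_open : IsOpen s := by
    have := ContinuousMap.isOpen_setOfPred_mapsTo (X := K) (Y := ℝ) isCompact_univ
      (isOpen_Iio (a := (0 : ℝ)))
    convert this using 1
    ext g
    simp [s, Set.MapsTo]
  have hs_conv : Convex ℝ s := by
    intro f hf g hg a b ha hb hab φ
    have h1 := hf φ
    have h2 := hg φ
    simp only [ContinuousMap.add_apply, ContinuousMap.smul_apply, smul_eq_mul]
    rcases ha.eq_or_lt with rfl | ha'
    · have : b = 1 := by linarith
      subst this; linarith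
    · nlinarith [mul_neg_of_pos_of_neg ha' h1, mul_nonneg hb (neg_nonneg.2 h2.le)]
  have hdisj : Disjoint s (convexHull ℝ (Set.range F)) := by
    rw [Set.disjoint_left]
    intro g hg hgc
    obtain ⟨J, _, w, z, hw, -, hz, rfl⟩ := mem_convexHull_iff_exists_fintype.1 hgc
    choose i hi using hz
    obtain ⟨φ, hφ⟩ := pietsch_weighted F hF J w i hw
    have := hg φ
    simp only [ContinuousMap.coe_sum, Finset.sum_apply, ContinuousMap.smul_apply,
      smul_eq_mul, ← hi] at this
    linarith
  obtain ⟨l, u, hl, hu⟩ := geometric_hahn_banach_open hs_conv hs_open (convex_convexHull ℝ _) hdisj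
  have hscale : ∀ g ∈ s, ∀ r : ℝ, 0 < r → r * l g < u := by
    intro g hg r hr
    have : r • g ∈ s := fun φ => by
      simpa using mul_neg_of_pos_of_neg hr (hg φ)
    simpa using hl _ this
  have hneg : ∀ g ∈ s, l g ≤ 0 := by
    intro g hg
    by_contra! hpos
    have h1 := hscale g hg ((|u| + 1) / l g) (by positivity)
    rw [div_mul_cancel₀ _ hpos.ne'] at h1
    linarith [le_abs_self u]
  have hone : (-1 : C(K, ℝ)) ∈ s := fun φ => by simp
  have hu0 : 0 ≤ u := by
    by_contra! hlt
    have h0 := hneg _ hone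
    have h1 := hscale _ hone ((-u / 2) / (|l (-1)| + 1)) (by
      have : 0 < -u / 2 := by linarith
      positivity)
    rw [abs_of_nonpos h0, div_mul_eq_mul_div, div_lt_iff₀ (by linarith)] at h1
    nlinarith
  have hpos : ∀ g : C(K, ℝ), (∀ φ, 0 ≤ g φ) → 0 ≤ l g := by
    intro g hg
    by_contra! hlt
    have key : ∀ ε : ℝ, 0 < ε → -l g ≤ ε * l 1 := by
      intro ε hε
      have : -g + ε • (-1 : C(K, ℝ)) ∈ s := fun φ => by
        have := hg φ
        simp; linarith
      have := hneg _ this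
      simp at this
      linarith
    have h1 := hneg _ hone
    rw [map_neg] at h1
    have h2 := key ((-l g / 2) / (l 1 + 1)) (div_pos (by linarith) (by linarith))
    rw [div_mul_eq_mul_div, le_div_iff₀ (by linarith)] at h2
    nlinarith
  have hl1 : 0 < l 1 := by
    have h1 := hpos 1 (fun φ => by simp)
    rcases h1.eq_or_lt with h0 | h0
    · exfalso
      have hz : ∀ g : C(K, ℝ), 0 ≤ l g := by
        intro g
        have := hpos (‖g‖ • (1 : C(K, ℝ)) + g) (fun φ => by
          have := (abs_le.1 (g.norm_coe_le_norm φ)).1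
          simp; linarith)
        simpa [← h0] using this
      obtain ⟨i⟩ := ‹Nonempty ι›
      have h2 := hu (F i) (subset_convexHull _ _ ⟨i, rfl⟩)
      have h3 := hl _ hone
      have h4 := hz (-F i)
      rw [map_neg] at h3 h4
      linarith
    · exact h0
  let Λ₀ : CompactlySupportedContinuousMap K ℝ →ₗ[ℝ] ℝ :=
    { toFun := fun f => (l 1)⁻¹ * l f.toContinuousMap
      map_add' := fun f g => by
        have : (f + g).toContinuousMap = f.toContinuousMap + g.toContinuousMap := rfl
        rw [this, map_add, mul_add]
      map_smul' := fun r f => by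
        have : (r • f).toContinuousMap = r • f.toContinuousMap := rfl
        rw [this, map_smul]
        simp only [smul_eq_mul, RingHom.id_apply]
        ring }
  let Λ : CompactlySupportedContinuousMap K ℝ →ₚ[ℝ] ℝ := PositiveLinearMap.mk₀ Λ₀ (fun f hf =>
    mul_nonneg (inv_nonneg.2 hl1.le) (hpos _ fun φ => hf φ))
  have hint : ∀ g : C(K, ℝ), ∫ φ, g φ ∂(RealRMK.rieszMeasure Λ) = (l 1)⁻¹ * l g := by
    intro g
    exact RealRMK.integral_rieszMeasure Λ (CompactlySupportedContinuousMap.continuousMapEquiv g)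
  refine ⟨RealRMK.rieszMeasure Λ, ?_, ?_⟩
  · have h1 := hint 1
    rw [inv_mul_cancel₀ hl1.ne'] at h1
    simp only [ContinuousMap.one_apply, integral_const, smul_eq_mul, mul_one] at h1
    constructor
    rw [measureReal_def] at h1
    exact (ENNReal.toReal_eq_one_iff _).1 h1
  · intro i
    rw [hint]
    exact mul_nonneg (inv_nonneg.2 hl1.le)
      (hu0.trans (hu (F i) (subset_convexHull _ _ ⟨i, rfl⟩)))

/-- **General Pietsch Domination Theorem.** With `X, Y, E` nonempty sets, `H` a nonempty family
of maps `X → Y`, `G` a Banach space, `K` a (nonempty) compact Hausdorff space, `S` arbitrary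
nonnegative and `R` nonnegative with `φ ↦ R(φ,x,b)` continuous, a map `h ∈ H` is `RS`-abstract
`p`-summing iff there are `C ≥ 0` and a Borel probability measure `μ` on `K` with
`S(h,e,b) ≤ C·(∫_K R(φ,e,b)^p dμ(φ))^(1/p)` for all `e ∈ E`, `b ∈ G`. -/
theorem abstract_pietsch_domination {X : Type u₁} {Y : Type u₂} {E : Type u₃} {G : Type u₄}
    {K : Type u₅} [Nonempty X] [Nonempty Y] [Nonempty E]
    [NormedAddCommGroup G] [NormedSpace ℝ G] [CompleteSpace G]
    [TopologicalSpace K] [CompactSpace K] [T2Space K] [Nonempty K]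
    [MeasurableSpace K] [BorelSpace K]
    (H : Set (X → Y)) (hH : H.Nonempty)
    (R : K → E → G → ℝ) (S : (X → Y) → E → G → ℝ)
    (hR : ∀ φ x b, 0 ≤ R φ x b) (hS : ∀ f x b, 0 ≤ S f x b)
    (hRcont : ∀ x b, Continuous fun φ => R φ x b)
    (p : ℝ) (hp : 1 ≤ p) (h : X → Y) (hh : h ∈ H) :
    RSSumming R S p h ↔
      ∃ (C : ℝ) (μ : Measure K), 0 ≤ C ∧ IsProbabilityMeasure μ ∧
        ∀ (e : E) (b : G), S h e b ≤ C * (∫ φ, R φ e b ^ p ∂μ) ^ (1 / p) := by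
  have hp0 : 0 < p := by linarith
  have hcont : ∀ e b, Continuous fun φ => R φ e b ^ p := fun e b =>
    (hRcont e b).rpow_const fun _ => Or.inr hp0.le
  have hmaxi : ∀ (m : ℕ) (x : Fin m → E) (b : Fin m → G), ∃ φ₀ : K,
      (∀ φ, ∑ j, R φ (x j) (b j) ^ p ≤ ∑ j, R φ₀ (x j) (b j) ^ p) ∧
      (⨆ φ : K, (∑ j, R φ (x j) (b j) ^ p) ^ (1 / p)) =
        (∑ j, R φ₀ (x j) (b j) ^ p) ^ (1 / p) := by
    intro m x b
    have hc : Continuous fun φ => ∑ j, R φ (x j) (b j) ^ p :=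
      continuous_finsetSum _ fun j _ => hcont _ _
    obtain ⟨φ₀, -, hmax⟩ := isCompact_univ.exists_isMaxOn (Set.univ_nonempty (α := K))
      hc.continuousOn
    have hle : ∀ φ, ∑ j, R φ (x j) (b j) ^ p ≤ ∑ j, R φ₀ (x j) (b j) ^ p :=
      fun φ => hmax (Set.mem_univ φ)
    have hle' : ∀ φ, (∑ j, R φ (x j) (b j) ^ p) ^ (1 / p) ≤
        (∑ j, R φ₀ (x j) (b j) ^ p) ^ (1 / p) := fun φ =>
      Real.rpow_le_rpow (Finset.sum_nonneg fun j _ => Real.rpow_nonneg (hR _ _ _) _) (hle φ)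
        (by positivity)
    refine ⟨φ₀, hle, le_antisymm (ciSup_le hle') ?_⟩
    exact le_ciSup (f := fun φ => (∑ j, R φ (x j) (b j) ^ p) ^ (1 / p))
      ⟨_, by rintro _ ⟨φ, rfl⟩; exact hle' φ⟩ φ₀
  have hroot : ∀ a C c : ℝ, 0 ≤ a → 0 ≤ C → 0 ≤ c →
      (a ^ (1 / p) ≤ C * c ^ (1 / p) ↔ a ≤ C ^ p * c) := by
    intro a C c ha hC hc
    rw [← Real.rpow_le_rpow_iff (Real.rpow_nonneg ha _)
      (mul_nonneg hC (Real.rpow_nonneg hc _)) hp0,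
      Real.mul_rpow hC (Real.rpow_nonneg hc _), ← Real.rpow_mul ha, ← Real.rpow_mul hc,
      one_div_mul_cancel hp0.ne', Real.rpow_one, Real.rpow_one]
  have hself : ∀ a : ℝ, 0 ≤ a → a = (a ^ p) ^ (1 / p) := fun a ha => by
    rw [← Real.rpow_mul ha, mul_one_div_cancel hp0.ne', Real.rpow_one]
  constructor
  · rintro ⟨C, hC, hsum⟩
    let F : E × G → C(K, ℝ) := fun q =>
      ⟨fun φ => C ^ p * R φ q.1 q.2 ^ p - S h q.1 q.2 ^ p,
        (continuous_const.mul (hcont _ _)).sub continuous_const⟩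
    have hF : ∀ (m : ℕ) (i : Fin m → E × G), ∃ φ, 0 ≤ ∑ j, F (i j) φ := by
      intro m i
      obtain ⟨φ₀, -, hsup⟩ := hmaxi m (fun j => (i j).1) (fun j => (i j).2)
      have h1 := hsum m (fun j => (i j).1) (fun j => (i j).2)
      rw [hsup, hroot _ _ _ (Finset.sum_nonneg fun j _ => Real.rpow_nonneg (hS _ _ _) _) hC
        (Finset.sum_nonneg fun j _ => Real.rpow_nonneg (hR _ _ _) _)] at h1
      refine ⟨φ₀, ?_⟩
      simp only [F, ContinuousMap.coe_mk, Finset.sum_sub_distrib, ← Finset.mul_sum]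
      linarith
    obtain ⟨μ, hμ, hpos⟩ := pietsch_measure F hF
    refine ⟨C, μ, hC, hμ, fun e b => ?_⟩
    have h1 := hpos (e, b)
    have hint : Integrable (fun φ => R φ e b ^ p) μ :=
      (hcont e b).integrable_of_hasCompactSupport (HasCompactSupport.of_compactSpace _)
    simp only [F, ContinuousMap.coe_mk] at h1
    rw [integral_sub (hint.const_mul _) (integrable_const _), integral_const_mul] at h1
    simp only [integral_const, probReal_univ, one_smul] at h1
    rw [hself _ (hS h e b), hroot _ _ _ (Real.rpow_nonneg (hS _ _ _) _) hC
      (integral_nonneg fun φ => Real.rpow_nonneg (hR _ _ _) _)]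
    linarith
  · rintro ⟨C, μ, hC, hμ, hdom⟩
    refine ⟨C, hC, fun m x b => ?_⟩
    obtain ⟨φ₀, hle, hsup⟩ := hmaxi m x b
    have hint : ∀ e b, Integrable (fun φ => R φ e b ^ p) μ := fun e b =>
      (hcont e b).integrable_of_hasCompactSupport (HasCompactSupport.of_compactSpace _)
    rw [hsup, hroot _ _ _ (Finset.sum_nonneg fun j _ => Real.rpow_nonneg (hS _ _ _) _) hC
        (Finset.sum_nonneg fun j _ => Real.rpow_nonneg (hR _ _ _) _)]
    calc ∑ j, S h (x j) (b j) ^ p ≤ ∑ j, C ^ p * ∫ φ, R φ (x j) (b j) ^ p ∂μ := by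
          refine Finset.sum_le_sum fun j _ => ?_
          rw [← hroot _ _ _ (Real.rpow_nonneg (hS _ _ _) _) hC
            (integral_nonneg fun φ => Real.rpow_nonneg (hR _ _ _) _), ← hself _ (hS _ _ _)]
          exact hdom _ _
      _ = C ^ p * ∫ φ, ∑ j, R φ (x j) (b j) ^ p ∂μ := by
          rw [← Finset.mul_sum, integral_finset_sum _ fun j _ => hint _ _]
      _ ≤ C ^ p * ∫ _φ, ∑ j, R φ₀ (x j) (b j) ^ p ∂μ := by
          refine mul_le_mul_of_nonneg_left ?_ (Real.rpow_nonneg hC _)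
          exact integral_mono (integrable_finset_sum _ fun j _ => hint _ _)
            (integrable_const _) hle
      _ = _ := by simp
end
end

section
/- Let X, Y, E be nonempty sets, H(X;Y) a nonempty family of maps from X to Y, G a Banach space, K a compact Hausdorff topological space, S : H(X;Y) × E × G → [0,∞) arbitrary, and R : K × E × G → [0,∞) such that φ ↦ R(φ, x, b) is continuous on K for every x ∈ E, b ∈ G. Let 1 ≤ q ≤ p < ∞. If h ∈ H(X;Y) is RS-abstract q-summing, then h is RS-abstract p-summing; moreover, any constant C witnessing the domination S(h,e,b) ≤ C·(∫_K R(φ,e,b)^q dμ(φ))^{1/q} for a Borel probability measure μ on K also witnesses S(h,e,b) ≤ C·(∫_K R(φ,e,b)^p dμ(φ))^{1/p}. -/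
open scoped BigOperators
open Finset MeasureTheory

noncomputable section

/-- Repetition of entries: integer weights. -/
lemma nat_weights {K E G H : Type*} [TopologicalSpace K] [Nonempty K]
    (R : K → E → G → ℝ) (S : H → E → G → ℝ) (q : ℝ) (hq : 1 ≤ q) (f : H)
    (hR : ∀ φ x b, 0 ≤ R φ x b) (hS : ∀ f x b, 0 ≤ S f x b)
    (C : ℝ) (hC : 0 ≤ C)
    (hyp : ∀ (m : ℕ) (x : Fin m → E) (b : Fin m → G),
      (∑ j, S f (x j) (b j) ^ q) ^ (1 / q) ≤
      C * ⨆ φ : K, (∑ j, R φ (x j) (b j) ^ q) ^ (1 / q))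
    (m : ℕ) (x : Fin m → E) (b : Fin m → G) (n : Fin m → ℕ) (L : ℝ)
    (hL : ∀ φ, ∑ j, (n j : ℝ) * R φ (x j) (b j) ^ q ≤ L) :
    ∑ j, (n j : ℝ) * S f (x j) (b j) ^ q ≤ C ^ q * L := by
  have hq0 : 0 < q := by linarith
  let e := Fintype.equivFin (Σ j : Fin m, Fin (n j))
  have key : ∀ g : Fin m → ℝ,
      ∑ i, g (e.symm i).1 = ∑ j, (n j : ℝ) * g j := by
    intro g
    rw [Equiv.sum_comp e.symm (fun y => g y.1), Fintype.sum_sigma]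
    simp
  have h1 := hyp _ (fun i => x (e.symm i).1) (fun i => b (e.symm i).1)
  have k1 := key (fun j => S f (x j) (b j) ^ q)
  have k2 := fun φ => key (fun j => R φ (x j) (b j) ^ q)
  simp only [k1, k2] at h1
  have hn1 : ∀ φ, 0 ≤ ∑ j, (n j : ℝ) * R φ (x j) (b j) ^ q := fun φ =>
    Finset.sum_nonneg fun j _ => mul_nonneg (Nat.cast_nonneg _) (Real.rpow_nonneg (hR _ _ _) _)
  have hn2 : 0 ≤ ∑ j, (n j : ℝ) * S f (x j) (b j) ^ q :=
    Finset.sum_nonneg fun j _ => mul_nonneg (Nat.cast_nonneg _) (Real.rpow_nonneg (hS _ _ _) _)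
  have hL0 : 0 ≤ L := (hn1 (Classical.arbitrary K)).trans (hL _)
  have h2 : (⨆ φ : K, (∑ j, (n j : ℝ) * R φ (x j) (b j) ^ q) ^ (1 / q)) ≤ L ^ (1 / q) :=
    ciSup_le fun φ => Real.rpow_le_rpow (hn1 φ) (hL φ) (by positivity)
  have h3 := h1.trans (mul_le_mul_of_nonneg_left h2 hC)
  have h4 := Real.rpow_le_rpow (Real.rpow_nonneg hn2 _) h3 hq0.le
  rwa [Real.mul_rpow hC (Real.rpow_nonneg hL0 _), ← Real.rpow_mul hn2, ← Real.rpow_mul hL0,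
    one_div_mul_cancel hq0.ne', Real.rpow_one, Real.rpow_one] at h4

/-- Nonnegative real weights. -/
lemma real_weights {K E G H : Type*} [TopologicalSpace K] [Nonempty K]
    (R : K → E → G → ℝ) (S : H → E → G → ℝ) (q : ℝ) (hq : 1 ≤ q) (f : H)
    (hR : ∀ φ x b, 0 ≤ R φ x b) (hS : ∀ f x b, 0 ≤ S f x b)
    (C : ℝ) (hC : 0 ≤ C)
    (hyp : ∀ (m : ℕ) (x : Fin m → E) (b : Fin m → G),
      (∑ j, S f (x j) (b j) ^ q) ^ (1 / q) ≤
      C * ⨆ φ : K, (∑ j, R φ (x j) (b j) ^ q) ^ (1 / q))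
    (m : ℕ) (x : Fin m → E) (b : Fin m → G) (w : Fin m → ℝ) (hw : ∀ j, 0 ≤ w j) (L : ℝ)
    (hL : ∀ φ, ∑ j, w j * R φ (x j) (b j) ^ q ≤ L) :
    ∑ j, w j * S f (x j) (b j) ^ q ≤ C ^ q * L := by
  have hlim : Filter.Tendsto
      (fun N : ℝ => ∑ j, ((⌊w j * N⌋₊ : ℝ) / N) * S f (x j) (b j) ^ q) Filter.atTop
      (nhds (∑ j, w j * S f (x j) (b j) ^ q)) :=
    tendsto_finsetSum _ fun j _ => (tendsto_nat_floor_mul_div_atTop (hw j)).mul_const _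
  refine le_of_tendsto hlim ?_
  filter_upwards [Filter.eventually_gt_atTop (0 : ℝ)] with N hN
  have := nat_weights R S q hq f hR hS C hC hyp m x b (fun j => ⌊w j * N⌋₊) (N * L) (by
    intro φ
    refine le_trans ?_ (mul_le_mul_of_nonneg_left (hL φ) hN.le)
    rw [Finset.mul_sum]
    refine Finset.sum_le_sum fun j _ => ?_
    rw [← mul_assoc, mul_comm N]
    exact mul_le_mul_of_nonneg_right (Nat.floor_le (mul_nonneg (hw j) hN.le))
      (Real.rpow_nonneg (hR _ _ _) _))
  have e : ∑ j, ((⌊w j * N⌋₊ : ℝ) / N) * S f (x j) (b j) ^ q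
      = (∑ j, (⌊w j * N⌋₊ : ℝ) * S f (x j) (b j) ^ q) / N := by
    rw [Finset.sum_div]
    exact Finset.sum_congr rfl fun j _ => by ring
  rw [e, div_le_iff₀ hN]
  linarith

/-- **Inclusion for `RS`-abstract summing maps.** If `1 ≤ q ≤ p < ∞` and `h ∈ H` is
`RS`-abstract `q`-summing, then `h` is `RS`-abstract `p`-summing; moreover any constant `C`
witnessing the `q`-domination by a Borel probability measure `μ` also witnesses the
`p`-domination. -/
theorem abstract_summing_mono {X : Type u₁} {Y : Type u₂} {E : Type u₃} {G : Type u₄}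
    {K : Type u₅} [Nonempty X] [Nonempty Y] [Nonempty E]
    [NormedAddCommGroup G] [NormedSpace ℝ G] [CompleteSpace G]
    [TopologicalSpace K] [CompactSpace K] [T2Space K] [Nonempty K]
    [MeasurableSpace K] [BorelSpace K]
    (H : Set (X → Y)) (hH : H.Nonempty)
    (R : K → E → G → ℝ) (S : (X → Y) → E → G → ℝ)
    (hR : ∀ φ x b, 0 ≤ R φ x b) (hS : ∀ f x b, 0 ≤ S f x b)
    (hRcont : ∀ x b, Continuous fun φ => R φ x b)
    (p q : ℝ) (hq : 1 ≤ q) (hqp : q ≤ p) (h : X → Y) (hh : h ∈ H) :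
    (RSSumming R S q h → RSSumming R S p h) ∧
    ∀ (C : ℝ) (μ : Measure K), 0 ≤ C → IsProbabilityMeasure μ →
      (∀ (e : E) (b : G), S h e b ≤ C * (∫ φ, R φ e b ^ q ∂μ) ^ (1 / q)) →
      (∀ (e : E) (b : G), S h e b ≤ C * (∫ φ, R φ e b ^ p ∂μ) ^ (1 / p)) := by
  have hq0 : 0 < q := by linarith
  have hp0 : 0 < p := by linarith
  refine ⟨?_, ?_⟩
  · rintro ⟨C, hC, hyp⟩
    rcases hqp.eq_or_lt with rfl | hlt
    · exact ⟨C, hC, hyp⟩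
    refine ⟨C, hC, fun m x b => ?_⟩
    set M := ⨆ φ : K, (∑ j, R φ (x j) (b j) ^ p) ^ (1 / p) with hM
    set s := ∑ j, S h (x j) (b j) ^ p with hs
    have hRs : ∀ φ, 0 ≤ ∑ j, R φ (x j) (b j) ^ p := fun φ =>
      Finset.sum_nonneg fun j _ => Real.rpow_nonneg (hR _ _ _) _
    have hs0 : 0 ≤ s := Finset.sum_nonneg fun j _ => Real.rpow_nonneg (hS _ _ _) _
    have hM0 : 0 ≤ M := Real.iSup_nonneg fun φ => Real.rpow_nonneg (hRs φ) _
    have hcont : Continuous fun φ => (∑ j, R φ (x j) (b j) ^ p) ^ (1 / p) :=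
      (continuous_finsetSum _ fun j _ =>
        (hRcont (x j) (b j)).rpow_const fun _ => Or.inr hp0.le).rpow_const
        fun _ => Or.inr (by positivity)
    have hle : ∀ φ, (∑ j, R φ (x j) (b j) ^ p) ^ (1 / p) ≤ M := fun φ =>
      le_ciSup (isCompact_range hcont).bddAbove φ
    rcases hs0.eq_or_lt with h0 | hspos
    · rw [← h0, Real.zero_rpow (by positivity)]
      positivity
    have hconj : (p / (p - q)).HolderConjugate (p / q) := by
      rw [Real.holderConjugate_iff]
      have : 0 < p - q := by linarith
      refine ⟨by rw [lt_div_iff₀ this]; linarith, ?_⟩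
      field_simp
      ring
    have hpq : 0 < p - q := by linarith
    have main := real_weights R S q hq h hR hS C hC hyp m x b
      (fun j => S h (x j) (b j) ^ (p - q)) (fun j => Real.rpow_nonneg (hS _ _ _) _)
      (s ^ (1 - q / p) * M ^ q) (by
        intro φ
        have hol := Real.inner_le_Lp_mul_Lq_of_nonneg Finset.univ hconj
          (f := fun j => S h (x j) (b j) ^ (p - q)) (g := fun j => R φ (x j) (b j) ^ q)
          (fun j _ => Real.rpow_nonneg (hS _ _ _) _) (fun j _ => Real.rpow_nonneg (hR _ _ _) _)
        have e1 : ∀ j, (S h (x j) (b j) ^ (p - q)) ^ (p / (p - q)) = S h (x j) (b j) ^ p := by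
          intro j
          rw [← Real.rpow_mul (hS _ _ _)]
          congr 1
          field_simp
        have e2 : ∀ j, (R φ (x j) (b j) ^ q) ^ (p / q) = R φ (x j) (b j) ^ p := by
          intro j
          rw [← Real.rpow_mul (hR _ _ _)]
          congr 1
          field_simp
        simp only [e1, e2] at hol
        have e3 : 1 / (p / (p - q)) = 1 - q / p := by field_simp
        rw [e3] at hol
        refine hol.trans (mul_le_mul_of_nonneg_left ?_ (Real.rpow_nonneg hs0 _))
        have := Real.rpow_le_rpow (Real.rpow_nonneg (hRs φ) _) (hle φ) hq0.le
        rw [← Real.rpow_mul (hRs φ)] at this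
        have e4 : 1 / (p / q) = 1 / p * q := by field_simp
        rwa [e4])
    have e5 : ∑ j, S h (x j) (b j) ^ (p - q) * S h (x j) (b j) ^ q = s := by
      refine Finset.sum_congr rfl fun j _ => ?_
      rw [← Real.rpow_add_of_nonneg (hS _ _ _) hpq.le hq0.le, sub_add_cancel]
    simp only [e5] at main
    have e6 : s = s ^ (1 - q / p) * s ^ (q / p) := by
      rw [← Real.rpow_add hspos, sub_add_cancel, Real.rpow_one]
    have h7 : s ^ (q / p) ≤ (C * M) ^ q := by
      rw [Real.mul_rpow hC hM0]
      have hpos : 0 < s ^ (1 - q / p) := Real.rpow_pos_of_pos hspos _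
      refine le_of_mul_le_mul_left ?_ hpos
      rw [← e6]
      linarith
    have e8 : s ^ (q / p) = (s ^ (1 / p)) ^ q := by
      rw [← Real.rpow_mul hs0]
      congr 1
      field_simp
    rw [e8] at h7
    exact (Real.rpow_le_rpow_iff (Real.rpow_nonneg hs0 _) (by positivity) hq0).1 h7
  · intro C μ hC hμ hyp e b
    refine (hyp e b).trans (mul_le_mul_of_nonneg_left ?_ hC)
    have hint : ∀ t : ℝ, 0 ≤ t → Integrable (fun φ => R φ e b ^ t) μ := fun t ht =>
      ((hRcont e b).rpow_const fun _ => Or.inr ht).integrable_of_hasCompactSupport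
        (HasCompactSupport.of_compactSpace _)
    have hr : 1 ≤ p / q := by rwa [one_le_div hq0]
    have e2 : ∀ φ, (R φ e b ^ q) ^ (p / q) = R φ e b ^ p := by
      intro φ
      rw [← Real.rpow_mul (hR _ _ _)]
      congr 1
      field_simp
    have hI : 0 ≤ ∫ φ, R φ e b ^ q ∂μ := integral_nonneg fun φ => Real.rpow_nonneg (hR _ _ _) _
    have J := (convexOn_rpow hr).map_integral_le (μ := μ) (f := fun φ => R φ e b ^ q)
      (continuousOn_id.rpow_const fun _ _ => Or.inr (by positivity)) isClosed_Ici
      (Filter.Eventually.of_forall fun φ => Real.rpow_nonneg (hR _ _ _) _) (hint q hq0.le)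
      (by simpa only [Function.comp_def, e2] using hint p hp0.le)
    simp only [e2] at J
    have := Real.rpow_le_rpow (Real.rpow_nonneg hI _) J (by positivity : 0 ≤ 1 / p)
    rw [← Real.rpow_mul hI] at this
    have e4 : p / q * (1 / p) = 1 / q := by field_simp
    rwa [e4] at this
end
end

section
/- Let X and Y be metric spaces, 1 ≤ p < ∞, and T : X → Y a map. Then T is Lipschitz p-summing if and only if there exist a constant C ≥ 0 and a Borel probability measure μ on B_{X^#} (the set of real-valued Lipschitz functions on X with Lipschitz constant at most 1, which is compact Hausdorff in the topology of pointwise convergence when normalized to vanish at a fixed base point) such that d_Y(T(x), T(y)) ≤ C · (∫_{B_{X^#}} |f(x) − f(y)|^p dμ(f))^{1/p} for all x, y ∈ X. -/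
open scoped BigOperators ENNReal
open Finset MeasureTheory

noncomputable section

/-- `T` is Lipschitz `t`-summing with constant `C`:
`∑ᵢ d_Y(T xᵢ, T yᵢ)^t ≤ C^t · sup_{f ∈ B_{X^#}} ∑ᵢ |f xᵢ - f yᵢ|^t`, the sup running over
all real-valued Lipschitz functions on `X` with Lipschitz constant at most `1`. -/
def LipSummingWith {X Y : Type*} [MetricSpace X] [MetricSpace Y]
    (t : ℝ) (T : X → Y) (C : ℝ) : Prop :=
  ∀ (n : ℕ) (x y : Fin n → X),
    ∑ i, dist (T (x i)) (T (y i)) ^ t ≤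
      C ^ t * ⨆ f : {f : X → ℝ // LipschitzWith 1 f},
        ∑ i, |(f : X → ℝ) (x i) - (f : X → ℝ) (y i)| ^ t

/-- `T` is Lipschitz `t`-summing. -/
def LipSumming {X Y : Type*} [MetricSpace X] [MetricSpace Y] (t : ℝ) (T : X → Y) : Prop :=
  ∃ C : ℝ, 0 ≤ C ∧ LipSummingWith t T C

/-- The Lipschitz `t`-summing norm `π_t^L(T)`: the infimum of the admissible constants. -/
def piLip {X Y : Type*} [MetricSpace X] [MetricSpace Y] (t : ℝ) (T : X → Y) : ℝ :=
  sInf {C : ℝ | 0 ≤ C ∧ LipSummingWith t T C}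

/-- The unit ball `B_{X^#}` of the Lipschitz dual: real-valued Lipschitz functions on `X` with
Lipschitz constant at most `1`, normalized to vanish at the base point `x₀`, carrying the
topology of pointwise convergence (as a subspace of `X → ℝ` with the product topology). -/
def lipBall (X : Type*) [MetricSpace X] (x₀ : X) : Set (X → ℝ) :=
  {f | LipschitzWith 1 f ∧ f x₀ = 0}

instance (X : Type*) [MetricSpace X] (x₀ : X) : MeasurableSpace (lipBall X x₀) := borel _

instance (X : Type*) [MetricSpace X] (x₀ : X) : BorelSpace (lipBall X x₀) := ⟨rfl⟩

/-- Abstract minimax step: a set of continuous functions closed under addition, none of which is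
everywhere negative, is nonnegative in mean for some probability measure. -/
theorem exists_prob_of_addClosed {K : Type*} [TopologicalSpace K] [CompactSpace K] [T2Space K]
    [Nonempty K] [MeasurableSpace K] [BorelSpace K] (M : Set C(K, ℝ)) (h0 : (0 : C(K, ℝ)) ∈ M)
    (hadd : ∀ a ∈ M, ∀ b ∈ M, a + b ∈ M) (hM : ∀ m ∈ M, ∃ f, 0 ≤ m f) :
    ∃ μ : Measure K, IsProbabilityMeasure μ ∧ ∀ m ∈ M, 0 ≤ ∫ f, m f ∂μ := by
  have hsmul : ∀ m ∈ M, ∀ k : ℕ, (k : ℝ) • m ∈ M := by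
    intro m hm k
    induction k with
    | zero => simpa using h0
    | succ k ih =>
      have := hadd _ ih _ hm
      convert this using 1
      push_cast
      rw [add_smul, one_smul]
  let A : Set C(K, ℝ) := {g | ∃ B : ℝ, ∀ k : ℕ, ∃ m ∈ M, ‖(k : ℝ) • g - m‖ ≤ B}
  let N : Set C(K, ℝ) := {g | ∀ f, g f < 0}
  have hMA : M ⊆ A := fun m hm => ⟨0, fun k => ⟨_, hsmul m hm k, by simp⟩⟩
  have hAadd : ∀ a ∈ A, ∀ b ∈ A, a + b ∈ A := by
    rintro a ⟨B, hB⟩ b ⟨B', hB'⟩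
    refine ⟨B + B', fun k => ?_⟩
    obtain ⟨m, hm, h1⟩ := hB k
    obtain ⟨m', hm', h2⟩ := hB' k
    refine ⟨m + m', hadd _ hm _ hm', ?_⟩
    rw [show (k : ℝ) • (a + b) - (m + m') = ((k : ℝ) • a - m) + ((k : ℝ) • b - m') by
      rw [smul_add]; abel]
    exact (norm_add_le _ _).trans (add_le_add h1 h2)
  have hAsmul : ∀ a ∈ A, ∀ c : ℝ, 0 ≤ c → c • a ∈ A := by
    rintro a ⟨B, hB⟩ c hc
    refine ⟨‖a‖ + B, fun k => ?_⟩
    obtain ⟨m, hm, h1⟩ := hB ⌊(k : ℝ) * c⌋₊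
    refine ⟨m, hm, ?_⟩
    have hkc : 0 ≤ (k : ℝ) * c := by positivity
    rw [show (k : ℝ) • c • a - m = ((k : ℝ) * c - (⌊(k : ℝ) * c⌋₊ : ℝ)) • a
      + ((⌊(k : ℝ) * c⌋₊ : ℝ) • a - m) by rw [sub_smul, smul_smul]; abel]
    refine (norm_add_le _ _).trans (add_le_add ?_ h1)
    rw [norm_smul]
    have h2 := Nat.floor_le hkc
    have h3 := Nat.lt_floor_add_one ((k : ℝ) * c)
    have h4 : ‖(k : ℝ) * c - (⌊(k : ℝ) * c⌋₊ : ℝ)‖ ≤ 1 := by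
      rw [Real.norm_eq_abs, abs_le]; constructor <;> linarith
    calc _ ≤ 1 * ‖a‖ := by gcongr
      _ = ‖a‖ := one_mul _
  have hAconv : Convex ℝ A := by
    intro a ha b hb s t hs ht _
    exact hAadd _ (hAsmul _ ha _ hs) _ (hAsmul _ hb _ ht)
  have hNconv : Convex ℝ N := by
    intro a ha b hb s t hs ht hst f
    have h1 := ha f
    have h2 := hb f
    simp only [ContinuousMap.add_apply, ContinuousMap.smul_apply, smul_eq_mul]
    rcases hs.eq_or_lt with rfl | hs
    · have : t = 1 := by linarith
      subst this; linarith
    · nlinarith [mul_neg_of_pos_of_neg hs h1, mul_nonneg ht (neg_nonneg.2 h2.le)]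
  have hNopen : IsOpen N := by
    have := ContinuousMap.isOpen_setOfPred_mapsTo (X := K) (Y := ℝ) isCompact_univ
      (isOpen_Iio (a := (0 : ℝ)))
    convert this using 1
    ext g
    simp [N, Set.MapsTo]
  have hdisj : Disjoint N A := by
    rw [Set.disjoint_left]
    rintro g hg ⟨B, hB⟩
    obtain ⟨f₀, hf₀⟩ : ∃ f₀, ∀ f, g f ≤ g f₀ := by
      obtain ⟨f₀, -, h⟩ := isCompact_univ.exists_isMaxOn (Set.univ_nonempty (α := K))
        g.continuous.continuousOn
      exact ⟨f₀, fun f => h (Set.mem_univ f)⟩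
    have hneg : 0 < - g f₀ := by have := hg f₀; linarith
    obtain ⟨k, hk⟩ := exists_nat_gt (B / (- g f₀))
    rw [div_lt_iff₀ hneg] at hk
    obtain ⟨m, hm, h1⟩ := hB k
    obtain ⟨f, hf⟩ := hM m hm
    have h2 := (ContinuousMap.norm_coe_le_norm ((k : ℝ) • g - m) f).trans h1
    simp only [ContinuousMap.sub_apply, ContinuousMap.smul_apply, smul_eq_mul,
      Real.norm_eq_abs] at h2
    have h3 := (abs_le.1 h2).1
    have h4 : (k : ℝ) * g f ≤ k * g f₀ := by gcongr; exact hf₀ f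
    linarith
  obtain ⟨L, u, hL1, hL2⟩ := geometric_hahn_banach_open hNconv hNopen hAconv hdisj
  have hu : u ≤ 0 := by simpa using hL2 0 (hMA h0)
  have hLM : ∀ m ∈ M, 0 ≤ L m := by
    intro m hm
    by_contra! hlt
    obtain ⟨k, hk⟩ := exists_nat_gt (u / L m)
    rw [div_lt_iff_of_neg hlt] at hk
    have := hL2 _ (hMA (hsmul m hm k))
    simp only [map_smul, smul_eq_mul] at this
    linarith
  have hL1pos : 0 < L 1 := by
    have := hL1 (-1) (fun f => by simp)
    rw [map_neg] at this
    linarith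
  have hLpos : ∀ g : C(K, ℝ), (∀ f, 0 ≤ g f) → 0 ≤ L g := by
    intro g hg
    by_contra! hlt
    have h := hL1 (-(g + (- L g / L 1) • (1 : C(K, ℝ)))) (fun f => by
      have := hg f
      have h2 : 0 < - L g / L 1 := div_pos (by linarith) hL1pos
      simp only [ContinuousMap.neg_apply, ContinuousMap.add_apply, ContinuousMap.smul_apply,
        ContinuousMap.one_apply, smul_eq_mul, mul_one]
      linarith)
    rw [map_neg, map_add, map_smul, smul_eq_mul, div_mul_cancel₀ _ hL1pos.ne'] at h
    linarith
  let Λ₀ : CompactlySupportedContinuousMap K ℝ →ₗ[ℝ] ℝ :=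
    { toFun := fun g => (L 1)⁻¹ * L (g : C(K, ℝ))
      map_add' := fun a b => by
        rw [← mul_add, ← map_add]; rfl
      map_smul' := fun c a => by
        rw [RingHom.id_apply, smul_eq_mul, mul_left_comm, ← smul_eq_mul c, ← map_smul]; rfl }
  let Λ := PositiveLinearMap.mk₀ Λ₀ (fun g hg =>
    mul_nonneg (inv_nonneg.2 hL1pos.le) (hLpos _ (fun f => CompactlySupportedContinuousMap.le_def.1 hg f)))
  have hIntegral : ∀ g : C(K, ℝ), ∫ f, g f ∂(RealRMK.rieszMeasure Λ) = (L 1)⁻¹ * L g := fun g =>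
    RealRMK.integral_rieszMeasure Λ (CompactlySupportedContinuousMap.continuousMapEquiv g)
  refine ⟨RealRMK.rieszMeasure Λ, ?_, fun m hm => ?_⟩
  · have h1 := hIntegral 1
    rw [inv_mul_cancel₀ hL1pos.ne'] at h1
    simp only [ContinuousMap.one_apply, integral_const, smul_eq_mul, mul_one] at h1
    refine ⟨?_⟩
    rw [measureReal_def] at h1
    exact (ENNReal.toReal_eq_one_iff _).1 h1
  · rw [hIntegral]
    exact mul_nonneg (inv_nonneg.2 hL1pos.le) (hLM m hm)

theorem lipBall_isCompact {X : Type*} [MetricSpace X] (x₀ : X) : IsCompact (lipBall X x₀) := by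
  have hc : IsClosed (lipBall X x₀) :=
    (isClosed_setOfPred_lipschitzWith (α := X) (β := ℝ) 1).inter
      (isClosed_eq (continuous_apply x₀) continuous_const)
  refine (isCompact_univ_pi (fun x : X => isCompact_Icc (a := -dist x x₀) (b := dist x x₀)))
    |>.of_isClosed_subset hc ?_
  rintro f ⟨hf, hf0⟩ x -
  have := hf.dist_le_mul x x₀
  rw [hf0, Real.dist_eq, sub_zero, NNReal.coe_one, one_mul] at this
  exact abs_le.1 this

theorem lip_sum_le {X : Type*} [MetricSpace X] {p : ℝ} (hp : 1 ≤ p) {n : ℕ} (x y : Fin n → X)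
    {f : X → ℝ} (hf : LipschitzWith 1 f) :
    ∑ i, |f (x i) - f (y i)| ^ p ≤ ∑ i, dist (x i) (y i) ^ p := by
  refine Finset.sum_le_sum fun i _ => ?_
  have := hf.dist_le_mul (x i) (y i)
  rw [Real.dist_eq, NNReal.coe_one, one_mul] at this
  exact Real.rpow_le_rpow (abs_nonneg _) this (by linarith)

theorem lip_bddAbove {X : Type*} [MetricSpace X] {p : ℝ} (hp : 1 ≤ p) {n : ℕ} (x y : Fin n → X) :
    BddAbove (Set.range fun f : {f : X → ℝ // LipschitzWith 1 f} =>
      ∑ i, |(f : X → ℝ) (x i) - (f : X → ℝ) (y i)| ^ p) := by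
  refine ⟨∑ i, dist (x i) (y i) ^ p, ?_⟩
  rintro _ ⟨f, rfl⟩
  exact lip_sum_le hp x y f.2

/-- evaluation of `|f x - f y| ^ p` as a continuous function on the ball. -/
def lipEval {X : Type*} [MetricSpace X] (x₀ : X) {p : ℝ} (hp : 1 ≤ p) (x y : X) :
    C(lipBall X x₀, ℝ) where
  toFun f := |(f : X → ℝ) x - (f : X → ℝ) y| ^ p
  continuous_toFun := by
    refine Continuous.rpow_const ?_ (fun _ => Or.inr (by linarith))
    exact ((((continuous_apply x).comp continuous_subtype_val).sub
      ((continuous_apply y).comp continuous_subtype_val))).abs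

/-- **Pietsch domination for Lipschitz `p`-summing maps** (Farmer–Johnson). A map `T : X → Y`
between metric spaces is Lipschitz `p`-summing iff there are `C ≥ 0` and a Borel probability
measure `μ` on `B_{X^#}` such that
`d_Y(T x, T y) ≤ C·(∫_{B_{X^#}} |f x - f y|^p dμ(f))^(1/p)` for all `x, y ∈ X`. -/
theorem pietsch_domination_lipschitz {X : Type v} [MetricSpace X] {Y : Type w} [MetricSpace Y]
    (x₀ : X) (p : ℝ) (hp : 1 ≤ p) (T : X → Y) :
    LipSumming p T ↔
      ∃ (C : ℝ) (μ : Measure (lipBall X x₀)), 0 ≤ C ∧ IsProbabilityMeasure μ ∧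
        ∀ x y : X, dist (T x) (T y) ≤
          C * (∫ f, |(f : X → ℝ) x - (f : X → ℝ) y| ^ p ∂μ) ^ (1 / p) := by
  have : CompactSpace (lipBall X x₀) := isCompact_iff_compactSpace.1 (lipBall_isCompact x₀)
  have : Nonempty (lipBall X x₀) := ⟨⟨fun _ => 0, LipschitzWith.const' 0, rfl⟩⟩
  have : Nonempty {f : X → ℝ // LipschitzWith 1 f} := ⟨⟨fun _ => 0, LipschitzWith.const' 0⟩⟩
  have hp0 : 0 < p := by linarith
  constructor
  · rintro ⟨C, hC, h⟩
    have hCp : 0 ≤ C ^ p := Real.rpow_nonneg hC p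
    let φ : X → X → C(lipBall X x₀, ℝ) := fun x y =>
      C ^ p • lipEval x₀ hp x y - (dist (T x) (T y) ^ p) • (1 : C(lipBall X x₀, ℝ))
    let M : Set C(lipBall X x₀, ℝ) :=
      {m | ∃ (n : ℕ) (x y : Fin n → X), m = ∑ i, φ (x i) (y i)}
    obtain ⟨μ, hμ, hIntegral⟩ := exists_prob_of_addClosed M ⟨0, Fin.elim0, Fin.elim0, by simp⟩
      (by
        rintro _ ⟨n, x, y, rfl⟩ _ ⟨n', x', y', rfl⟩
        refine ⟨n + n', Fin.append x x', Fin.append y y', ?_⟩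
        rw [Fin.sum_univ_add]
        simp)
      (by
        rintro _ ⟨n, x, y, rfl⟩
        set m : C(lipBall X x₀, ℝ) := ∑ i, φ (x i) (y i) with hm
        have hmf : ∀ f : lipBall X x₀, m f =
            C ^ p * ∑ i, |(f : X → ℝ) (x i) - (f : X → ℝ) (y i)| ^ p
              - ∑ i, dist (T (x i)) (T (y i)) ^ p := by
          intro f
          rw [hm, ContinuousMap.sum_apply, Finset.mul_sum, ← Finset.sum_sub_distrib]
          refine Finset.sum_congr rfl fun i _ => ?_
          simp [φ, lipEval]
        obtain ⟨f₀, -, hf₀⟩ := isCompact_univ.exists_isMaxOn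
          (Set.univ_nonempty (α := lipBall X x₀)) m.continuous.continuousOn
        refine ⟨f₀, ?_⟩
        have h1 := h n x y
        rw [Real.mul_iSup_of_nonneg hCp] at h1
        have h2 : (⨆ f : {f : X → ℝ // LipschitzWith 1 f},
            C ^ p * ∑ i, |(f : X → ℝ) (x i) - (f : X → ℝ) (y i)| ^ p) ≤
            m f₀ + ∑ i, dist (T (x i)) (T (y i)) ^ p := by
          refine ciSup_le fun f => ?_
          have hg : LipschitzWith 1 (fun z => (f : X → ℝ) z - (f : X → ℝ) x₀) := by
            refine LipschitzWith.of_dist_le_mul fun a b => ?_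
            rw [dist_sub_right]
            exact f.2.dist_le_mul a b
          have h3 : m ⟨_, hg, sub_self _⟩ ≤ m f₀ := hf₀ (Set.mem_univ _)
          rw [hmf] at h3
          simp only [sub_sub_sub_cancel_right] at h3
          linarith
        linarith)
    refine ⟨C, μ, hC, hμ, fun x y => ?_⟩
    have h1 := hIntegral (φ x y) ⟨1, fun _ => x, fun _ => y, by simp⟩
    have hi : Integrable (lipEval x₀ hp x y) μ :=
      (lipEval x₀ hp x y).continuous.integrable_of_hasCompactSupport
        (HasCompactSupport.of_compactSpace _)
    have h2 : ∫ f, φ x y f ∂μ = C ^ p * (∫ f, |(f : X → ℝ) x - (f : X → ℝ) y| ^ p ∂μ)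
        - dist (T x) (T y) ^ p := by
      have : ∀ f, φ x y f = C ^ p * lipEval x₀ hp x y f - dist (T x) (T y) ^ p := by
        intro f; simp [φ]
      simp_rw [this]
      rw [integral_sub (hi.const_mul _) (integrable_const _), integral_const_mul]
      simp [lipEval]
    rw [h2, sub_nonneg] at h1
    have hI : 0 ≤ ∫ f : lipBall X x₀, |(f : X → ℝ) x - (f : X → ℝ) y| ^ p ∂μ :=
      integral_nonneg fun f => Real.rpow_nonneg (abs_nonneg _) _
    have h3 := Real.rpow_le_rpow (Real.rpow_nonneg dist_nonneg _) h1
      (one_div_nonneg.2 hp0.le)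
    rwa [Real.mul_rpow hCp hI, ← Real.rpow_mul dist_nonneg, ← Real.rpow_mul hC,
      mul_one_div_cancel hp0.ne', Real.rpow_one, Real.rpow_one] at h3
  · rintro ⟨C, μ, hC, hμ, h⟩
    refine ⟨C, hC, fun n x y => ?_⟩
    have hCp : 0 ≤ C ^ p := Real.rpow_nonneg hC p
    have hi : ∀ a b, Integrable (fun f : lipBall X x₀ => |(f : X → ℝ) a - (f : X → ℝ) b| ^ p) μ :=
      fun a b => (lipEval x₀ hp a b).continuous.integrable_of_hasCompactSupport
        (HasCompactSupport.of_compactSpace _)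
    calc ∑ i, dist (T (x i)) (T (y i)) ^ p
        ≤ ∑ i, C ^ p * ∫ f : lipBall X x₀, |(f : X → ℝ) (x i) - (f : X → ℝ) (y i)| ^ p ∂μ := by
          refine Finset.sum_le_sum fun i _ => ?_
          have hI : 0 ≤ ∫ f : lipBall X x₀, |(f : X → ℝ) (x i) - (f : X → ℝ) (y i)| ^ p ∂μ :=
            integral_nonneg fun f => Real.rpow_nonneg (abs_nonneg _) _
          have h3 := Real.rpow_le_rpow dist_nonneg (h (x i) (y i)) hp0.le
          rwa [Real.mul_rpow hC (Real.rpow_nonneg hI _), ← Real.rpow_mul hI,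
            one_div_mul_cancel hp0.ne', Real.rpow_one] at h3
      _ = C ^ p * ∫ f : lipBall X x₀,
            ∑ i, |(f : X → ℝ) (x i) - (f : X → ℝ) (y i)| ^ p ∂μ := by
          rw [integral_finsetSum _ (fun i _ => hi _ _), Finset.mul_sum]
      _ ≤ _ := by
          refine mul_le_mul_of_nonneg_left ?_ hCp
          have h4 := integral_mono (μ := μ)
            (integrable_finsetSum Finset.univ (fun i _ => hi (x i) (y i)))
            (integrable_const (⨆ f : {f : X → ℝ // LipschitzWith 1 f},
              ∑ i, |(f : X → ℝ) (x i) - (f : X → ℝ) (y i)| ^ p))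
            (fun f => le_ciSup (lip_bddAbove hp x y) ⟨f.1, f.2.1⟩)
          simpa using h4
end
end

section
/- Let 1 < r < p < ∞ and let X be a metric space. If every Lipschitz p-summing map from X to ℓ_p is Lipschitz r-summing (i.e., Π_p^L(X; ℓ_p) = Π_r^L(X; ℓ_p)), then for every Banach space Y, every Lipschitz p-summing map from X to Y is Lipschitz 1-summing (i.e., Π_p^L(X; Y) = Π_1^L(X; Y)). -/
open scoped BigOperators ENNReal
open Finset MeasureTheory

noncomputable section

/-- Weighted domination by Lipschitz functions (finite index type). -/
def WDom {X : Type*} [MetricSpace X] (q : ℝ) (D : X → X → ℝ) (K : ℝ) : Prop :=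
  ∀ (n : ℕ) (x y : Fin n → X) (t : Fin n → ℝ) (M : ℝ), (∀ i, 0 ≤ t i) →
    (∀ f : X → ℝ, LipschitzWith 1 f → ∑ i, t i * |f (x i) - f (y i)| ^ q ≤ M) →
    ∑ i, t i * D (x i) (y i) ≤ K * M

/-- Unweighted version. -/
def UDom {X : Type*} [MetricSpace X] (q : ℝ) (D : X → X → ℝ) (K : ℝ) : Prop :=
  ∀ (n : ℕ) (x y : Fin n → X) (M : ℝ),
    (∀ f : X → ℝ, LipschitzWith 1 f → ∑ i, |f (x i) - f (y i)| ^ q ≤ M) →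
    ∑ i, D (x i) (y i) ≤ K * M

lemma lip_abs_le {X : Type*} [MetricSpace X] {f : X → ℝ} (hf : LipschitzWith 1 f) (x y : X) :
    |f x - f y| ≤ dist x y := by
  have := hf.dist_le_mul x y
  simpa [Real.dist_eq] using this

lemma lip_le_sup {X : Type*} [MetricSpace X] {q : ℝ} (hq : 0 < q) {n : ℕ} (x y : Fin n → X)
    (f : X → ℝ) (hf : LipschitzWith 1 f) :
    ∑ i, |f (x i) - f (y i)| ^ q ≤ ⨆ f : {f : X → ℝ // LipschitzWith 1 f},
        ∑ i, |(f : X → ℝ) (x i) - (f : X → ℝ) (y i)| ^ q := by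
  refine le_ciSup (f := fun f : {f : X → ℝ // LipschitzWith 1 f} =>
        ∑ i, |(f : X → ℝ) (x i) - (f : X → ℝ) (y i)| ^ q) ?_ ⟨f, hf⟩
  refine ⟨∑ i, dist (x i) (y i) ^ q, ?_⟩
  rintro _ ⟨g, rfl⟩
  refine Finset.sum_le_sum fun i _ => ?_
  exact Real.rpow_le_rpow (abs_nonneg _) (lip_abs_le g.2 _ _) hq.le

lemma sup_le_lip {X : Type*} [MetricSpace X] {q : ℝ} {n : ℕ} (x y : Fin n → X) (M : ℝ)
    (h : ∀ f : X → ℝ, LipschitzWith 1 f → ∑ i, |f (x i) - f (y i)| ^ q ≤ M) :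
    (⨆ f : {f : X → ℝ // LipschitzWith 1 f},
        ∑ i, |(f : X → ℝ) (x i) - (f : X → ℝ) (y i)| ^ q) ≤ M := by
  have : Nonempty {f : X → ℝ // LipschitzWith 1 f} :=
    ⟨⟨fun _ => 0, LipschitzWith.const' 0⟩⟩
  exact ciSup_le fun f => h f.1 f.2

lemma UDom.of_summing {X Y : Type*} [MetricSpace X] [MetricSpace Y] {q : ℝ}
    {T : X → Y} (h : LipSumming q T) :
    ∃ K, 0 ≤ K ∧ UDom q (fun x y => dist (T x) (T y) ^ q) K := by
  obtain ⟨C, hC, h⟩ := h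
  refine ⟨C ^ q, Real.rpow_nonneg hC _, fun n x y M hM => (h n x y).trans ?_⟩
  exact mul_le_mul_of_nonneg_left (sup_le_lip x y M hM) (Real.rpow_nonneg hC _)

lemma UDom.fintype {X : Type*} [MetricSpace X] {q : ℝ} {D : X → X → ℝ} {K : ℝ}
    (h : UDom q D K) {ι : Type*} [Fintype ι] (x y : ι → X) (M : ℝ)
    (hM : ∀ f : X → ℝ, LipschitzWith 1 f → ∑ i, |f (x i) - f (y i)| ^ q ≤ M) :
    ∑ i, D (x i) (y i) ≤ K * M := by
  let e := Fintype.equivFin ι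
  have := h (Fintype.card ι) (x ∘ e.symm) (y ∘ e.symm) M (fun f hf => by
    refine le_trans (le_of_eq ?_) (hM f hf)
    exact Equiv.sum_comp e.symm (fun i => |f (x i) - f (y i)| ^ q))
  refine le_trans (le_of_eq ?_) this
  exact (Equiv.sum_comp e.symm (fun i => D (x i) (y i))).symm

lemma UDom.weighted {X : Type*} [MetricSpace X] {q : ℝ} {D : X → X → ℝ} {K : ℝ}
    (h : UDom q D K) : WDom q D K := by
  intro n x y t M ht hM
  have key : ∀ N : ℕ, ∑ i, (⌊t i * (N : ℝ)⌋₊ : ℝ) * D (x i) (y i) ≤ K * (M * N) := by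
    intro N
    have := h.fintype (ι := (i : Fin n) × Fin ⌊t i * (N : ℝ)⌋₊) (fun j => x j.1) (fun j => y j.1)
      (M * N) (fun f hf => by
        rw [Fintype.sum_sigma]
        simp only [Finset.sum_const, Finset.card_univ, Fintype.card_fin, nsmul_eq_mul]
        calc _ ≤ ∑ i, (t i * N) * |f (x i) - f (y i)| ^ q := by
              refine Finset.sum_le_sum fun i _ => ?_
              refine mul_le_mul_of_nonneg_right (Nat.floor_le ?_) (by positivity)
              have := ht i
              positivity
          _ = (∑ i, t i * |f (x i) - f (y i)| ^ q) * N := by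
              rw [Finset.sum_mul]
              exact Finset.sum_congr rfl fun i _ => by ring
          _ ≤ _ := mul_le_mul_of_nonneg_right (hM f hf) (by positivity))
    rw [Fintype.sum_sigma] at this
    simpa only [Finset.sum_const, Finset.card_univ, Fintype.card_fin, nsmul_eq_mul] using this
  have lim : Filter.Tendsto (fun N : ℕ => ∑ i, ((⌊t i * (N : ℝ)⌋₊ : ℝ) / N) * D (x i) (y i))
      Filter.atTop (nhds (∑ i, t i * D (x i) (y i))) := by
    refine tendsto_finsetSum _ fun i _ => ?_
    refine Filter.Tendsto.mul_const _ ?_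
    exact (tendsto_nat_floor_mul_div_atTop (R := ℝ) (ht i)).comp tendsto_natCast_atTop_atTop
  refine le_of_tendsto lim ?_
  filter_upwards [Filter.eventually_gt_atTop 0] with N hN
  have hN' : (0 : ℝ) < N := by exact_mod_cast hN
  have := key N
  have e : ∑ i, ((⌊t i * (N : ℝ)⌋₊ : ℝ) / N) * D (x i) (y i)
      = (∑ i, (⌊t i * (N : ℝ)⌋₊ : ℝ) * D (x i) (y i)) / N := by
    rw [Finset.sum_div]
    exact Finset.sum_congr rfl fun i _ => by ring
  rw [e, div_le_iff₀ hN']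
  linarith

/-- `∫ |f x - f y|^p dμ` for the discrete measure `μ = ∑ w k δ_{f k}`. -/
def Fint {X : Type*} (p : ℝ) (w : ℕ → ℝ) (f : ℕ → X → ℝ) (x y : X) : ℝ :=
  ∑' k, w k * |f k x - f k y| ^ p

lemma Fint_summable {X : Type*} [MetricSpace X] {p : ℝ} (hp : 0 < p) {w : ℕ → ℝ} {f : ℕ → X → ℝ}
    (hw : ∀ k, 0 ≤ w k) (hs : Summable w) (hf : ∀ k, LipschitzWith 1 (f k)) (x y : X) :
    Summable (fun k => w k * |f k x - f k y| ^ p) := by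
  refine Summable.of_nonneg_of_le (fun k => mul_nonneg (hw k) (by positivity)) (fun k => ?_)
    (hs.mul_right (dist x y ^ p))
  exact mul_le_mul_of_nonneg_left
    (Real.rpow_le_rpow (abs_nonneg _) (lip_abs_le (hf k) _ _) hp.le) (hw k)

lemma Fint_nonneg {X : Type*} {p : ℝ} {w : ℕ → ℝ} {f : ℕ → X → ℝ}
    (hw : ∀ k, 0 ≤ w k) (x y : X) : 0 ≤ Fint p w f x y :=
  tsum_nonneg fun k => mul_nonneg (hw k) (by positivity)

/-- The canonical map into `ℓ_p` attached to a discrete measure. -/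
lemma exists_map {X : Type*} [MetricSpace X] [Nonempty X] {p : ℝ} (hp : 1 < p)
    [Fact (1 ≤ ENNReal.ofReal p)] {w : ℕ → ℝ} {f : ℕ → X → ℝ}
    (hw : ∀ k, 0 ≤ w k) (hs : Summable w) (hf : ∀ k, LipschitzWith 1 (f k)) :
    ∃ T : X → lp (fun _ : ℕ => ℝ) (ENNReal.ofReal p),
      (∀ x y, dist (T x) (T y) ^ p = Fint p w f x y) ∧ LipSumming p T := by
  have hp0 : 0 < p := by linarith
  have hpr : (ENNReal.ofReal p).toReal = p := ENNReal.toReal_ofReal hp0.le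
  obtain ⟨x0⟩ := ‹Nonempty X›
  have hterm : ∀ x y k, ‖w k ^ (1 / p) * (f k x - f k y)‖ ^ p = w k * |f k x - f k y| ^ p := by
    intro x y k
    rw [Real.norm_eq_abs, abs_mul, Real.mul_rpow (abs_nonneg _) (abs_nonneg _),
      abs_of_nonneg (Real.rpow_nonneg (hw k) _), ← Real.rpow_mul (hw k)]
    rw [one_div_mul_cancel hp0.ne', Real.rpow_one]
  have hmem : ∀ x, Memℓp (fun k => w k ^ (1 / p) * (f k x - f k x0) : ℕ → ℝ)
      (ENNReal.ofReal p) := by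
    intro x
    refine memℓp_gen ?_
    rw [hpr]
    refine (Fint_summable hp0 hw hs hf x x0).congr fun k => ?_
    exact (hterm x x0 k).symm
  let T : X → lp (fun _ : ℕ => ℝ) (ENNReal.ofReal p) := fun x => ⟨_, hmem x⟩
  have hT : ∀ x y, dist (T x) (T y) ^ p = Fint p w f x y := by
    intro x y
    have h1 := lp.norm_rpow_eq_tsum (p := ENNReal.ofReal p) (by rw [hpr]; exact hp0) (T x - T y)
    rw [hpr] at h1
    rw [dist_eq_norm, h1]
    refine tsum_congr fun k => ?_
    rw [← hterm x y k]
    congr 2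
    change w k ^ (1 / p) * (f k x - f k x0) - w k ^ (1 / p) * (f k y - f k x0) = _
    ring
  refine ⟨T, hT, (∑' k, w k) ^ (1 / p), Real.rpow_nonneg (tsum_nonneg hw) _, ?_⟩
  intro n x y
  rw [← Real.rpow_mul (tsum_nonneg hw), one_div_mul_cancel hp0.ne', Real.rpow_one]
  simp only [hT, Fint]
  rw [← Summable.tsum_finsetSum (fun i _ => Fint_summable hp0 hw hs hf (x i) (y i)),
    ← tsum_mul_right]
  refine Summable.tsum_le_tsum (fun k => ?_)
    (summable_sum fun i _ => Fint_summable hp0 hw hs hf (x i) (y i)) (hs.mul_right _)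
  rw [← Finset.mul_sum]
  exact mul_le_mul_of_nonneg_left (lip_le_sup hp0 x y (f k) (hf k)) (hw k)

lemma udom_single {X : Type*} [MetricSpace X] [Nonempty X] {p r : ℝ} (hr : 1 < r) (hrp : r < p)
    [Fact (1 ≤ ENNReal.ofReal p)]
    (hyp : ∀ T : X → lp (fun _ : ℕ => ℝ) (ENNReal.ofReal p),
      LipSumming p T → LipSumming r T) {w : ℕ → ℝ} {f : ℕ → X → ℝ}
    (hw : ∀ k, 0 ≤ w k) (hs : Summable w) (hf : ∀ k, LipschitzWith 1 (f k)) :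
    ∃ K, 0 ≤ K ∧ UDom r (fun x y => Fint p w f x y ^ (r / p)) K := by
  obtain ⟨T, hT, hsum⟩ := exists_map (hr.trans hrp) hw hs hf
  obtain ⟨K, hK, h⟩ := UDom.of_summing (hyp T hsum)
  refine ⟨K, hK, ?_⟩
  have : (fun x y => Fint p w f x y ^ (r / p)) = fun x y => dist (T x) (T y) ^ r := by
    funext x y
    rw [← hT, ← Real.rpow_mul dist_nonneg, mul_div_cancel₀ _ (by linarith)]
  rw [this]
  exact h

lemma glide_summable {w : ℕ → ℕ → ℝ} (hw : ∀ N k, 0 ≤ w N k) (hs : ∀ N, HasSum (w N) 1) :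
    Summable (fun q : ℕ × ℕ => (1 / 2 : ℝ) ^ q.1 * w q.1 q.2) := by
  refine (summable_prod_of_nonneg fun q => mul_nonneg (by positivity) (hw _ _)).2 ⟨?_, ?_⟩
  · intro N
    have := (hs N).summable.mul_left ((1 / 2 : ℝ) ^ N)
    exact this
  · have h : ∀ N, ∑' k, (1 / 2 : ℝ) ^ N * w N k = (1 / 2) ^ N := fun N => by
      rw [tsum_mul_left, (hs N).tsum_eq, mul_one]
    simp only [h]
    exact summable_geometric_two

/-- Uniformity of the constant, by a gliding hump. -/
lemma udom_uniform {X : Type*} [MetricSpace X] [Nonempty X] {p r : ℝ} (hr : 1 < r) (hrp : r < p)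
    [Fact (1 ≤ ENNReal.ofReal p)]
    (hyp : ∀ T : X → lp (fun _ : ℕ => ℝ) (ENNReal.ofReal p),
      LipSumming p T → LipSumming r T) :
    ∃ K, 0 ≤ K ∧ ∀ (w : ℕ → ℝ) (f : ℕ → X → ℝ), (∀ k, 0 ≤ w k) → HasSum w 1 →
      (∀ k, LipschitzWith 1 (f k)) → UDom r (fun x y => Fint p w f x y ^ (r / p)) K := by
  have hp0 : 0 < p := by linarith
  by_contra! hcon
  choose w f hw hs hf hbad using fun N : ℕ => hcon ((4 : ℝ) ^ N) (by positivity)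
  obtain ⟨e⟩ : Nonempty (ℕ ≃ ℕ × ℕ) := ⟨Nat.pairEquiv.symm⟩
  let w2 : ℕ × ℕ → ℝ := fun q => (1 / 2) ^ q.1 * w q.1 q.2
  have hw2 : ∀ q, 0 ≤ w2 q := fun q => mul_nonneg (by positivity) (hw _ _)
  have hs2 : Summable w2 := glide_summable hw hs
  obtain ⟨K, hK, hU⟩ := udom_single hr hrp hyp (w := w2 ∘ e) (f := fun k => f (e k).1 (e k).2)
    (fun k => hw2 _) ((Equiv.summable_iff e).2 hs2) (fun k => hf _ _)
  obtain ⟨N, hN⟩ := pow_unbounded_of_one_lt K (one_lt_two : (1 : ℝ) < 2)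
  refine hbad N fun n x y M hM => ?_
  have hM0 : 0 ≤ M := le_trans (Finset.sum_nonneg fun i _ => by positivity)
    (hM (fun _ => 0) (LipschitzWith.const' 0))
  have hcmp : ∀ x y, Fint p (w N) (f N) x y ≤
      2 ^ N * Fint p (w2 ∘ e) (fun k => f (e k).1 (e k).2) x y := by
    intro x y
    have hsum := Fint_summable hp0 (w := w2 ∘ e) (f := fun k => f (e k).1 (e k).2)
      (fun k => hw2 _) ((Equiv.summable_iff e).2 hs2) (fun k => hf _ _) x y
    let G : ℕ × ℕ → ℝ := fun q => w2 q * |f q.1 q.2 x - f q.1 q.2 y| ^ p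
    have hG : Summable G := (Equiv.summable_iff e).1 hsum
    have e1 : Fint p (w2 ∘ e) (fun k => f (e k).1 (e k).2) x y = ∑' q, G q := Equiv.tsum_eq e G
    have e2 : Fint p (w N) (f N) x y = 2 ^ N * ∑' k, G (N, k) := by
      rw [Fint, ← tsum_mul_left]
      refine tsum_congr fun k => ?_
      simp only [G, w2]
      rw [← mul_assoc, ← mul_assoc, ← mul_pow]
      norm_num
    rw [e1, e2]
    refine mul_le_mul_of_nonneg_left ?_ (by positivity)
    rw [hG.tsum_prod]
    refine hG.prod.le_tsum N fun j _ => tsum_nonneg fun k => ?_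
    exact mul_nonneg (hw2 _) (by positivity)
  calc ∑ i, Fint p (w N) (f N) (x i) (y i) ^ (r / p)
      ≤ ∑ i, 2 ^ N * Fint p (w2 ∘ e) (fun k => f (e k).1 (e k).2) (x i) (y i) ^ (r / p) := by
        refine Finset.sum_le_sum fun i _ => ?_
        have hn := Fint_nonneg (p := p) (w := w2 ∘ e) (f := fun k => f (e k).1 (e k).2)
          (fun k => hw2 _) (x i) (y i)
        refine (Real.rpow_le_rpow (Fint_nonneg (hw N) _ _) (hcmp _ _) (by positivity)).trans ?_
        rw [Real.mul_rpow (by positivity) hn]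
        refine mul_le_mul_of_nonneg_right ?_ (Real.rpow_nonneg hn _)
        calc ((2 : ℝ) ^ N) ^ (r / p) ≤ ((2 : ℝ) ^ N) ^ (1 : ℝ) :=
              Real.rpow_le_rpow_of_exponent_le (one_le_pow₀ (by norm_num))
                ((div_le_one hp0).2 hrp.le)
          _ = 2 ^ N := Real.rpow_one _
    _ ≤ 2 ^ N * (K * M) := by
        rw [← Finset.mul_sum]
        exact mul_le_mul_of_nonneg_left (hU n x y M hM) (by positivity)
    _ ≤ 2 ^ N * (2 ^ N * M) := by gcongr
    _ = 4 ^ N * M := by rw [← mul_assoc, ← mul_pow]; norm_num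

/-- The set of vectors `(∫ |f x_i - f y_i|^p dμ)_i`. -/
def Vset {X : Type*} [MetricSpace X] (p : ℝ) {n : ℕ} (x y : Fin n → X) : Set (Fin n → ℝ) :=
  {v | ∃ (w : ℕ → ℝ) (f : ℕ → X → ℝ), (∀ k, 0 ≤ w k) ∧ HasSum w 1 ∧
    (∀ k, LipschitzWith 1 (f k)) ∧ v = fun i => Fint p w f (x i) (y i)}

lemma Vset_nonempty {X : Type*} [MetricSpace X] (p : ℝ) {n : ℕ} (x y : Fin n → X) :
    (Vset p x y).Nonempty :=
  ⟨_, fun k => if k = 0 then 1 else 0, fun _ _ => 0, fun k => by dsimp only; split_ifs <;> norm_num,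
    hasSum_ite_eq 0 1, fun _ => LipschitzWith.const' 0, rfl⟩

lemma Vset_bound {X : Type*} [MetricSpace X] {p : ℝ} (hp : 0 < p) {n : ℕ} (x y : Fin n → X) :
    Vset p x y ⊆ Set.Icc 0 (fun i => dist (x i) (y i) ^ p) := by
  rintro _ ⟨w, f, hw, hs, hf, rfl⟩
  refine ⟨fun i => Fint_nonneg hw _ _, fun i => ?_⟩
  have h2 := hs.mul_right (dist (x i) (y i) ^ p)
  rw [one_mul] at h2
  change Fint p w f (x i) (y i) ≤ dist (x i) (y i) ^ p
  rw [← h2.tsum_eq]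
  refine Summable.tsum_le_tsum (fun k => ?_) (Fint_summable hp hw hs.summable hf _ _) h2.summable
  exact mul_le_mul_of_nonneg_left
    (Real.rpow_le_rpow (abs_nonneg _) (lip_abs_le (hf k) _ _) hp.le) (hw k)

lemma Vset_segment {X : Type*} [MetricSpace X] {p : ℝ} (hp : 0 < p) {n : ℕ} (x y : Fin n → X)
    {g : X → ℝ} (hg : LipschitzWith 1 g) {s : ℝ} (hs0 : 0 ≤ s) (hs1 : s ≤ 1)
    {v : Fin n → ℝ} (hv : v ∈ Vset p x y) :
    (fun i => (1 - s) * v i + s * |g (x i) - g (y i)| ^ p) ∈ Vset p x y := by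
  obtain ⟨w, f, hw, hs, hf, rfl⟩ := hv
  let w' : ℕ → ℝ := fun k => Nat.casesOn k s (fun j => (1 - s) * w j)
  let f' : ℕ → X → ℝ := fun k => Nat.casesOn k g f
  have hw' : ∀ k, 0 ≤ w' k := by
    rintro (_ | k)
    · exact hs0
    · exact mul_nonneg (by linarith) (hw k)
  have hf' : ∀ k, LipschitzWith 1 (f' k) := by
    rintro (_ | k)
    · exact hg
    · exact hf k
  have hs' : HasSum w' 1 := by
    rw [← hasSum_nat_add_iff' 1]
    have := hs.mul_left (1 - s)
    simpa [w'] using this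
  refine ⟨w', f', hw', hs', hf', ?_⟩
  funext i
  change (1 - s) * (∑' k, w k * |f k (x i) - f k (y i)| ^ p) + _ =
    ∑' k, w' k * |f' k (x i) - f' k (y i)| ^ p
  rw [(Fint_summable hp hw' hs'.summable hf' (x i) (y i)).tsum_eq_zero_add,
    ← tsum_mul_left, add_comm]
  congr 1
  refine tsum_congr fun k => ?_
  change _ = (1 - s) * w k * _
  rw [mul_assoc]

lemma Vset_closure_segment {X : Type*} [MetricSpace X] {p : ℝ} (hp : 0 < p) {n : ℕ}
    (x y : Fin n → X)
    {g : X → ℝ} (hg : LipschitzWith 1 g) {s : ℝ} (hs0 : 0 ≤ s) (hs1 : s ≤ 1)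
    {v : Fin n → ℝ} (hv : v ∈ closure (Vset p x y)) :
    (fun i => (1 - s) * v i + s * |g (x i) - g (y i)| ^ p) ∈ closure (Vset p x y) := by
  refine map_mem_closure (f := fun v : Fin n → ℝ =>
    (fun i => (1 - s) * v i + s * |g (x i) - g (y i)| ^ p)) (by fun_prop) hv ?_
  exact fun u hu => Vset_segment hp x y hg hs0 hs1 hu

/-- First-order optimality condition. -/
lemma optimality {n : ℕ} {p ε : ℝ} (hp : 0 < p) (hε : 0 < ε) {v a : Fin n → ℝ} (hv : ∀ i, 0 ≤ v i)
    (hmax : ∀ s : ℝ, 0 ≤ s → s ≤ 1 →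
      ∑ i, ((1 - s) * v i + s * a i + ε) ^ (1 / p) ≤ ∑ i, (v i + ε) ^ (1 / p)) :
    ∑ i, ((v i + ε) ^ (1 / p)) ^ (1 - p) * a i ≤ ∑ i, (v i + ε) ^ (1 / p) := by
  let φ : ℝ → ℝ := fun s => ∑ i, ((1 - s) * v i + s * a i + ε) ^ (1 / p)
  have hpow : ∀ i, ((v i + ε) ^ (1 / p)) ^ (1 - p) = (v i + ε) ^ (1 / p - 1) := by
    intro i
    have := hv i
    rw [← Real.rpow_mul (by positivity)]
    congr 1
    field_simp
  have hd : HasDerivAt φ (∑ i, (a i - v i) * (1 / p) * (v i + ε) ^ (1 / p - 1)) 0 := by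
    refine HasDerivAt.fun_sum fun i _ => ?_
    have h1 : HasDerivAt (fun s : ℝ => (1 - s) * v i + s * a i + ε) (a i - v i) 0 := by
      have := ((((hasDerivAt_id (0 : ℝ)).const_sub 1).mul_const (v i)).add
        ((hasDerivAt_id (0 : ℝ)).mul_const (a i))).add_const ε
      refine this.congr_deriv ?_
      ring
    have := h1.rpow_const (p := 1 / p) (Or.inl (by have := hv i; simp; positivity))
    simpa using this
  have hle : ∑ i, (a i - v i) * (1 / p) * (v i + ε) ^ (1 / p - 1) ≤ 0 := by
    have ht := (hasDerivAt_iff_tendsto_slope.1 hd).mono_left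
      (nhdsWithin_mono (0 : ℝ) (s := Set.Ioi 0) (fun z hz => (ne_of_gt hz : z ≠ 0)))
    refine le_of_tendsto ht ?_
    filter_upwards [Ioo_mem_nhdsGT (zero_lt_one : (0 : ℝ) < 1)] with s hs
    rw [slope_def_field]
    refine div_nonpos_of_nonpos_of_nonneg ?_ (by linarith [hs.1])
    have h0 : φ 0 = ∑ i, (v i + ε) ^ (1 / p) := by simp [φ]
    rw [h0]
    linarith [hmax s hs.1.le hs.2.le]
  have hle2 : ∑ i, ((v i + ε) ^ (1 / p)) ^ (1 - p) * (a i - v i) ≤ 0 := by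
    have : ∑ i, (a i - v i) * (1 / p) * (v i + ε) ^ (1 / p - 1)
        = (1 / p) * ∑ i, ((v i + ε) ^ (1 / p)) ^ (1 - p) * (a i - v i) := by
      rw [Finset.mul_sum]
      exact Finset.sum_congr rfl fun i _ => by rw [hpow]; ring
    rw [this] at hle
    by_contra! hc
    have : 0 < 1 / p := by positivity
    nlinarith [mul_pos this hc]
  have hle3 : ∑ i, ((v i + ε) ^ (1 / p)) ^ (1 - p) * v i ≤ ∑ i, (v i + ε) ^ (1 / p) := by
    refine Finset.sum_le_sum fun i _ => ?_
    have := hv i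
    have hpos : 0 < v i + ε := by positivity
    calc _ ≤ ((v i + ε) ^ (1 / p)) ^ (1 - p) * (v i + ε) :=
          mul_le_mul_of_nonneg_left (by linarith) (by positivity)
      _ = (v i + ε) ^ (1 / p) := by
          rw [hpow, Real.rpow_sub_one hpos.ne']
          field_simp
  simp only [mul_sub, Finset.sum_sub_distrib] at hle2
  linarith

lemma scalar_young {p r δ : ℝ} (hr : 1 < r) (hrp : r < p) (hδ : 0 < δ) :
    ∃ L, 0 ≤ L ∧ ∀ m b : ℝ, 0 < m → 0 ≤ b →
      m ^ (1 - r) * b ^ r ≤ L * b + δ * (m ^ (1 - p) * b ^ p) := by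
  set a : ℝ := δ ^ (1 / (r - p)) with ha
  have ha0 : 0 < a := by positivity
  have hrp' : r - p ≠ 0 := by linarith
  have hap : a ^ (r - p) = δ := by
    rw [ha, ← Real.rpow_mul hδ.le, one_div_mul_cancel hrp', Real.rpow_one]
  refine ⟨a ^ (r - 1), by positivity, fun m b hm hb => ?_⟩
  rcases hb.eq_or_lt with rfl | hb
  · simp [Real.zero_rpow (by linarith : r ≠ 0), Real.zero_rpow (by linarith : p ≠ 0)]
  have e1 : m ^ (1 - r) * b ^ r = (b / m) ^ (r - 1) * b := by
    rw [Real.div_rpow hb.le hm.le, Real.rpow_sub_one hb.ne', ← neg_sub r 1, Real.rpow_neg hm.le]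
    field_simp
  have e2 : m ^ (1 - r) * b ^ r = (b / m) ^ (r - p) * (m ^ (1 - p) * b ^ p) := by
    rw [Real.div_rpow hb.le hm.le, Real.rpow_sub hb, Real.rpow_sub hm, Real.rpow_sub hm,
      Real.rpow_sub hm]
    field_simp
  rcases le_total (b / m) a with h | h
  · have h1 : (b / m) ^ (r - 1) ≤ a ^ (r - 1) := Real.rpow_le_rpow (by positivity) h (by linarith)
    have h2 : 0 ≤ δ * (m ^ (1 - p) * b ^ p) := by positivity
    rw [e1]
    nlinarith
  · have h1 : (b / m) ^ (r - p) ≤ a ^ (r - p) :=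
      Real.rpow_le_rpow_of_nonpos ha0 h (by linarith)
    rw [hap] at h1
    have h2 : 0 ≤ m ^ (1 - p) * b ^ p := by positivity
    have h3 : 0 ≤ a ^ (r - 1) * b := by positivity
    rw [e2]
    nlinarith

lemma scalar_simple {p : ℝ} (hp : 1 < p) {m d : ℝ} (hm : 0 < m) (hd : 0 ≤ d) :
    d ≤ m + m ^ (1 - p) * d ^ p := by
  have hpos : 0 ≤ m ^ (1 - p) * d ^ p := by positivity
  rcases le_total d m with h | h
  · linarith
  · have hd0 : 0 < d := by linarith
    have e : m ^ (1 - p) * d ^ p = (d / m) ^ (p - 1) * d := by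
      rw [Real.div_rpow hd0.le hm.le, Real.rpow_sub_one hd0.ne', ← neg_sub p 1,
        Real.rpow_neg hm.le]
      field_simp
    have : 1 ≤ (d / m) ^ (p - 1) :=
      Real.one_le_rpow ((one_le_div hm).2 h) (by linarith)
    rw [e]
    nlinarith

lemma scalar_eps {p r ε v : ℝ} (hr : 1 < r) (hrp : r < p) (hε : 0 < ε) (hv : 0 ≤ v) :
    (v + ε) ^ (1 / p) - ε ^ (1 / p) ≤ ((v + ε) ^ (1 / p)) ^ (1 - r) * v ^ (r / p) := by
  have hp0 : 0 < p := by linarith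
  have hpos : 0 < v + ε := by positivity
  have e1 : ((v + ε) ^ (1 / p)) ^ (1 - r) * v ^ (r / p)
      = (v + ε) ^ (1 / p) * (v / (v + ε)) ^ (r / p) := by
    rw [Real.div_rpow hv hpos.le, ← Real.rpow_mul hpos.le,
      show 1 / p * (1 - r) = 1 / p - r / p by ring, Real.rpow_sub hpos]
    ring
  have hu0 : 0 ≤ v / (v + ε) := by positivity
  have hu1 : v / (v + ε) ≤ 1 := (div_le_one hpos).2 (by linarith)
  have h1 : v / (v + ε) ≤ (v / (v + ε)) ^ (r / p) := by
    have := Real.rpow_le_rpow_of_exponent_ge' hu0 hu1 (z := r / p) (by positivity)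
      ((div_le_one hp0).2 hrp.le : r / p ≤ 1)
    simpa using this
  have h2 : (v + ε) ^ (1 / p) * (v / (v + ε)) = (v + ε) ^ (1 / p) - ε * (v + ε) ^ (1 / p - 1) := by
    rw [Real.rpow_sub_one hpos.ne']
    field_simp
    ring
  have h3 : (v + ε) ^ (1 / p - 1) ≤ ε ^ (1 / p - 1) :=
    Real.rpow_le_rpow_of_nonpos hε (by linarith) (by
      have : 1 / p ≤ 1 := (div_le_one hp0).2 (by linarith)
      linarith)
  have h4 : ε * ε ^ (1 / p - 1) = ε ^ (1 / p) := by
    rw [Real.rpow_sub_one hε.ne']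
    field_simp
  have h5 := mul_le_mul_of_nonneg_left h3 hε.le
  have h6 := mul_le_mul_of_nonneg_left h1 (Real.rpow_nonneg hpos.le (1 / p))
  rw [e1]
  linarith

lemma main_bound {X : Type*} [MetricSpace X] {p r : ℝ} (hr : 1 < r) (hrp : r < p)
    {K Kp δ L : ℝ} (hKp : 0 ≤ Kp) (hKδ : K * δ ≤ 1 / 2) (hδ : 0 < δ)
    (hU : ∀ (w : ℕ → ℝ) (f : ℕ → X → ℝ), (∀ k, 0 ≤ w k) → HasSum w 1 →
      (∀ k, LipschitzWith 1 (f k)) → UDom r (fun x y => Fint p w f x y ^ (r / p)) K)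
    {D : X → X → ℝ} (hD : ∀ x y, 0 ≤ D x y) (hDp : UDom p (fun x y => D x y ^ p) Kp)
    (hL0 : 0 ≤ L) (hL : ∀ m b : ℝ, 0 < m → 0 ≤ b →
      m ^ (1 - r) * b ^ r ≤ L * b + δ * (m ^ (1 - p) * b ^ p))
    {n : ℕ} (x y : Fin n → X) (S : ℝ)
    (hS : ∀ f : X → ℝ, LipschitzWith 1 f → ∑ i, |f (x i) - f (y i)| ≤ S)
    {ε : ℝ} (hε : 0 < ε) :
    ∑ i, D (x i) (y i) ≤ (1 + Kp) * (2 * (n * ε ^ (1 / p)) + 2 * (K * (L * S))) := by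
  have hp0 : 0 < p := by linarith
  have hsub : closure (Vset p x y) ⊆ Set.Icc 0 (fun i => dist (x i) (y i) ^ p) :=
    closure_minimal (Vset_bound hp0 x y) isClosed_Icc
  have hcpt : IsCompact (closure (Vset p x y)) :=
    isCompact_Icc.of_isClosed_subset isClosed_closure hsub
  have hp1 : 0 ≤ 1 / p := by positivity
  obtain ⟨v, hv, hvmax⟩ := hcpt.exists_isMaxOn (Vset_nonempty p x y).closure
    (f := fun v : Fin n → ℝ => ∑ i, (v i + ε) ^ (1 / p))
    (Continuous.continuousOn (continuous_finsetSum _ fun i _ =>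
      ((continuous_apply i).add continuous_const).rpow_const fun _ => Or.inr hp1))
  have hv0 : ∀ i, 0 ≤ v i := fun i => (hsub hv).1 i
  set m : Fin n → ℝ := fun i => (v i + ε) ^ (1 / p) with hm
  have hmpos : ∀ i, 0 < m i := fun i => Real.rpow_pos_of_pos (by have := hv0 i; positivity) _
  set B : ℝ := ∑ i, m i with hB
  have h1 : ∀ g : X → ℝ, LipschitzWith 1 g →
      ∑ i, m i ^ (1 - p) * |g (x i) - g (y i)| ^ p ≤ B := by
    intro g hg
    refine optimality hp0 hε hv0 fun s hs0 hs1 => ?_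
    exact hvmax (Vset_closure_segment hp0 x y hg hs0 hs1 hv)
  have h2 : ∑ i, m i ^ (1 - p) * D (x i) (y i) ^ p ≤ Kp * B :=
    hDp.weighted n x y (fun i => m i ^ (1 - p)) B
      (fun i => Real.rpow_nonneg (hmpos i).le _) h1
  have h3 : ∑ i, D (x i) (y i) ≤ (1 + Kp) * B := by
    calc _ ≤ ∑ i, (m i + m i ^ (1 - p) * D (x i) (y i) ^ p) :=
          Finset.sum_le_sum fun i _ => scalar_simple (hr.trans hrp) (hmpos i) (hD _ _)
      _ ≤ _ := by rw [Finset.sum_add_distrib]; linarith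
  have h4 : ∀ g : X → ℝ, LipschitzWith 1 g →
      ∑ i, m i ^ (1 - r) * |g (x i) - g (y i)| ^ r ≤ L * S + δ * B := by
    intro g hg
    calc _ ≤ ∑ i, (L * |g (x i) - g (y i)| + δ * (m i ^ (1 - p) * |g (x i) - g (y i)| ^ p)) :=
          Finset.sum_le_sum fun i _ => hL _ _ (hmpos i) (abs_nonneg _)
      _ ≤ _ := by
          rw [Finset.sum_add_distrib, ← Finset.mul_sum, ← Finset.mul_sum]
          exact add_le_add (mul_le_mul_of_nonneg_left (hS g hg) hL0)
            (mul_le_mul_of_nonneg_left (h1 g hg) hδ.le)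
  have h5 : ∑ i, m i ^ (1 - r) * v i ^ (r / p) ≤ K * (L * S + δ * B) := by
    have hcl : IsClosed {u : Fin n → ℝ | ∑ i, m i ^ (1 - r) * u i ^ (r / p)
        ≤ K * (L * S + δ * B)} := by
      refine isClosed_le (continuous_finsetSum _ fun i _ => ?_) continuous_const
      exact continuous_const.mul ((continuous_apply i).rpow_const fun _ => Or.inr (by positivity))
    refine closure_minimal ?_ hcl hv
    rintro _ ⟨w, f, hw, hs, hf, rfl⟩
    exact (hU w f hw hs hf).weighted n x y (fun i => m i ^ (1 - r)) _
      (fun i => Real.rpow_nonneg (hmpos i).le _) h4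
  have h6 : B - n * ε ^ (1 / p) ≤ ∑ i, m i ^ (1 - r) * v i ^ (r / p) := by
    calc B - n * ε ^ (1 / p) = ∑ i, (m i - ε ^ (1 / p)) := by
          simp [Finset.sum_sub_distrib, hB]
      _ ≤ _ := Finset.sum_le_sum fun i _ => scalar_eps hr hrp hε (hv0 i)
  have hB0 : 0 ≤ B := Finset.sum_nonneg fun i _ => (hmpos i).le
  have h7 : B ≤ 2 * (n * ε ^ (1 / p)) + 2 * (K * (L * S)) := by
    have := mul_le_mul_of_nonneg_right hKδ hB0
    nlinarith
  exact h3.trans (mul_le_mul_of_nonneg_left h7 (by linarith))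

/-- **Extrapolation theorem for Lipschitz `p`-summing maps** (Chen–Zheng). If `1 < r < p < ∞`
and every Lipschitz `p`-summing map from the metric space `X` to `ℓ_p` is Lipschitz
`r`-summing, then for every Banach space `Y`, every Lipschitz `p`-summing map `X → Y` is
Lipschitz `1`-summing. -/
theorem extrapolation_lipschitz {X : Type v} [MetricSpace X]
    (p r : ℝ) (hr : 1 < r) (hrp : r < p) [Fact (1 ≤ ENNReal.ofReal p)]
    (hyp : ∀ T : X → lp (fun _ : ℕ => ℝ) (ENNReal.ofReal p),
      LipSumming p T → LipSumming r T) :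
    ∀ (Y : Type w) [NormedAddCommGroup Y] [NormedSpace ℝ Y] [CompleteSpace Y],
      ∀ T : X → Y, LipSumming p T → LipSumming 1 T := by
  intro Y _ _ _ T hT
  have hp0 : 0 < p := by linarith
  rcases isEmpty_or_nonempty X with hX | hX
  · refine ⟨0, le_rfl, fun n x y => ?_⟩
    rw [Finset.sum_eq_zero fun i _ => isEmptyElim (x i)]
    simp
  obtain ⟨K, hK, hU⟩ := udom_uniform hr hrp hyp
  obtain ⟨Kp, hKp, hDp⟩ := UDom.of_summing hT
  have hδ : 0 < 1 / (2 * (K + 1)) := by positivity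
  have hKδ : K * (1 / (2 * (K + 1))) ≤ 1 / 2 := by
    rw [mul_one_div, div_le_div_iff₀ (by positivity) (by norm_num)]
    linarith
  obtain ⟨L, hL0, hL⟩ := scalar_young hr hrp hδ
  refine ⟨(1 + Kp) * (2 * (K * L)), by positivity, fun n x y => ?_⟩
  simp only [Real.rpow_one]
  set S := ⨆ f : {f : X → ℝ // LipschitzWith 1 f},
        ∑ i, |(f : X → ℝ) (x i) - (f : X → ℝ) (y i)| with hSdef
  have hS : ∀ f : X → ℝ, LipschitzWith 1 f → ∑ i, |f (x i) - f (y i)| ≤ S := by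
    intro f hf
    have := lip_le_sup (q := 1) one_pos x y f hf
    simpa only [Real.rpow_one] using this
  have hlim : Filter.Tendsto (fun ε : ℝ =>
      (1 + Kp) * (2 * (n * ε ^ (1 / p)) + 2 * (K * (L * S)))) (nhdsWithin 0 (Set.Ioi 0))
      (nhds ((1 + Kp) * (2 * (n * (0 : ℝ) ^ (1 / p)) + 2 * (K * (L * S))))) := by
    have hc : Continuous (fun ε : ℝ =>
      (1 + Kp) * (2 * (n * ε ^ (1 / p)) + 2 * (K * (L * S)))) := by
      have : Continuous fun ε : ℝ => ε ^ (1 / p) :=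
        continuous_id.rpow_const fun _ => Or.inr (by positivity)
      fun_prop
    exact (hc.tendsto 0).mono_left nhdsWithin_le_nhds
  have hfin := ge_of_tendsto hlim (b := ∑ i, dist (T (x i)) (T (y i))) (by
    filter_upwards [self_mem_nhdsWithin] with ε hε
    exact main_bound hr hrp hKp hKδ hδ hU (D := fun x y => dist (T x) (T y))
      (fun _ _ => dist_nonneg) hDp hL0 hL x y S hS hε)
  rw [Real.zero_rpow (by positivity)] at hfin
  refine hfin.trans (le_of_eq ?_)
  ring
end
end
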